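/- arXiv:2301.05257 — 6 statements merged into one kernel-verified Lean document; each statement's English description precedes it below -/
import Mathlib

section
/- Let $Y$ be a real random variable with the Cauchy distribution $C(\mu,\sigma)$, i.e. with density $f(y;\mu,\sigma) = \sigma/(\pi(\sigma^2+(y-\mu)^2))$, where $\mu\in\mathbb{R}$ and $\sigma>0$, and write $\theta = \mu + i\sigma \in \mathbb{C}$. Let $a,b,c,d \in \mathbb{R}$ with $ad-bc > 0$. Then the random variable $Y^* = (aY+b)/(cY+d)$ (defined off the null set $\{Y = -d/c\}$ when $c \neq 0$) has the Cauchy distribution $C(\mu^*,\sigma^*)$, where $\mu^* = \operatorname{Re}\big((a\theta+b)/(c\theta+d)\big)$ and $\sigma^* = \operatorname{Im}\big((a\theta+b)/(c\theta+d)\big) > 0$. -/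
open MeasureTheory Real Complex

/-- The Cauchy distribution `C(μ, σ)` with location `μ` and scale `σ > 0`,
given by the density `x ↦ (π σ)⁻¹ (1 + (x - μ)²/σ²)⁻¹` w.r.t. Lebesgue measure. -/
noncomputable def cauchyMeasure (μ σ : ℝ) : Measure ℝ :=
  volume.withDensity fun x => ENNReal.ofReal ((π * σ)⁻¹ * (1 + (x - μ) ^ 2 / σ ^ 2)⁻¹)

open Set in
/-- The affine form `x ↦ p x + q`, if not identically zero, vanishes only on a null set. -/
lemma ae_mul_add_ne_zero {p q : ℝ} (h : p ≠ 0 ∨ q ≠ 0) : ∀ᵐ x : ℝ, p * x + q ≠ 0 := by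
  have hs : {x : ℝ | p * x + q = 0}.Subsingleton := by
    intro x hx y hy
    simp only [mem_ofPred_eq] at hx hy
    have hp : p ≠ 0 := by
      rintro rfl
      simp_all
    exact mul_left_cancel₀ hp (by linarith)
  simpa [ae_iff] using hs.measure_zero volume

lemma cauchyMeasure_ne_zero (μ : ℝ) {σ : ℝ} (hσ : 0 < σ) : cauchyMeasure μ σ ≠ 0 := by
  intro h
  rw [cauchyMeasure, withDensity_eq_zero_iff (by fun_prop)] at h
  obtain ⟨x, hx⟩ := h.exists
  have hpos : 0 < (π * σ)⁻¹ * (1 + (x - μ) ^ 2 / σ ^ 2)⁻¹ := by positivity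
  exact (ENNReal.ofReal_pos.2 hpos).ne' hx

lemma normSq_denom_pos {σ c d : ℝ} (hσ : 0 < σ) (h : c ≠ 0 ∨ d ≠ 0) (μ : ℝ) :
    0 < (c * μ + d) ^ 2 + (c * σ) ^ 2 := by
  by_cases hc : c = 0
  · have hd : d ≠ 0 := h.resolve_left (not_not.2 hc)
    subst hc
    simp only [zero_mul, zero_add]
    positivity
  · positivity

lemma moebius_re (μ σ a b c d : ℝ) :
    (((a : ℂ) * (μ + σ * Complex.I) + b) / ((c : ℂ) * (μ + σ * Complex.I) + d)).re =
      ((a * μ + b) * (c * μ + d) + a * c * σ ^ 2) / ((c * μ + d) ^ 2 + (c * σ) ^ 2) := by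
  simp only [Complex.div_re, Complex.normSq_apply, Complex.add_re, Complex.add_im, Complex.mul_re,
    Complex.mul_im, Complex.ofReal_re, Complex.ofReal_im, Complex.I_re, Complex.I_im]
  rw [← add_div]
  congr 1 <;> ring

lemma moebius_im (μ σ a b c d : ℝ) :
    (((a : ℂ) * (μ + σ * Complex.I) + b) / ((c : ℂ) * (μ + σ * Complex.I) + d)).im =
      σ * (a * d - b * c) / ((c * μ + d) ^ 2 + (c * σ) ^ 2) := by
  simp only [Complex.div_im, Complex.normSq_apply, Complex.add_re, Complex.add_im, Complex.mul_re,
    Complex.mul_im, Complex.ofReal_re, Complex.ofReal_im, Complex.I_re, Complex.I_im]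
  rw [← sub_div]
  congr 1 <;> ring

lemma hasDerivAt_moebius (a b : ℝ) {c d x : ℝ} (hx : c * x + d ≠ 0) :
    HasDerivAt (fun x : ℝ => (a * x + b) / (c * x + d))
      ((a * d - b * c) / (c * x + d) ^ 2) x := by
  have hn : HasDerivAt (fun x : ℝ => a * x + b) a x := by
    simpa using ((hasDerivAt_id x).const_mul a).add_const b
  have hd : HasDerivAt (fun x : ℝ => c * x + d) c x := by
    simpa using ((hasDerivAt_id x).const_mul c).add_const d
  exact (hn.div hd hx).congr_deriv (by ring)

lemma injOn_moebius {a b c d : ℝ} (h : a * d - b * c ≠ 0) :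
    Set.InjOn (fun x : ℝ => (a * x + b) / (c * x + d)) {x | c * x + d ≠ 0} := by
  intro x hx y hy hxy
  have hxy' := (div_eq_div_iff hx hy).1 hxy
  exact mul_left_cancel₀ h (by linarith)

/-- A Möbius map sends the complement of its pole onto the complement of the image of infinity. -/
lemma image_moebius_preimage {a b c d : ℝ} (h : a * d - b * c ≠ 0) (A : Set ℝ) :
    (fun x : ℝ => (a * x + b) / (c * x + d)) ''
      ((fun x : ℝ => (a * x + b) / (c * x + d)) ⁻¹' A ∩ {x | c * x + d ≠ 0}) =
      A ∩ {y | -c * y + a ≠ 0} := by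
  ext y
  constructor
  · rintro ⟨x, ⟨hxA, hx⟩, rfl⟩
    have hx' : c * x + d ≠ 0 := hx
    refine ⟨hxA, ?_⟩
    have heq : -c * ((a * x + b) / (c * x + d)) + a = (a * d - b * c) / (c * x + d) := by
      field_simp
      ring
    simpa only [Set.mem_ofPred_eq, heq] using div_ne_zero h hx'
  · rintro ⟨hyA, hy⟩
    have hy' : -c * y + a ≠ 0 := hy
    have hden : c * ((d * y - b) / (-c * y + a)) + d = (a * d - b * c) / (-c * y + a) := by
      rw [eq_div_iff hy', add_mul, mul_assoc, div_mul_cancel₀ _ hy']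
      ring
    have hnum : a * ((d * y - b) / (-c * y + a)) + b =
        y * ((a * d - b * c) / (-c * y + a)) := by
      rw [← mul_div_assoc y, eq_div_iff hy', add_mul, mul_assoc, div_mul_cancel₀ _ hy']
      ring
    have hval : (a * ((d * y - b) / (-c * y + a)) + b) /
        (c * ((d * y - b) / (-c * y + a)) + d) = y := by
      rw [hden, hnum, mul_div_cancel_right₀ _ (div_ne_zero h hy')]
    refine ⟨(d * y - b) / (-c * y + a), ⟨?_, ?_⟩, hval⟩
    · simpa only [Set.mem_preimage, hval] using hyA
    · simpa only [Set.mem_ofPred_eq, hden] using div_ne_zero h hy'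

lemma cauchy_density_eq {σ : ℝ} (hσ : σ ≠ 0) (μ x : ℝ) :
    (π * σ)⁻¹ * (1 + (x - μ) ^ 2 / σ ^ 2)⁻¹ = σ / (π * (σ ^ 2 + (x - μ) ^ 2)) := by
  have : σ ^ 2 + (x - μ) ^ 2 ≠ 0 := by positivity
  field_simp

/-- Transformation rule of the Cauchy density under a real Möbius map. -/
lemma cauchy_density_moebius {μ σ a b c d x : ℝ} (hσ : 0 < σ) (h : 0 < a * d - b * c)
    (hx : c * x + d ≠ 0) {m s N : ℝ} (hN : N = (c * μ + d) ^ 2 + (c * σ) ^ 2) (hN0 : 0 < N)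
    (hm : m = ((a * μ + b) * (c * μ + d) + a * c * σ ^ 2) / N)
    (hs : s = σ * (a * d - b * c) / N) :
    (a * d - b * c) / (c * x + d) ^ 2 *
        ((π * s)⁻¹ * (1 + ((a * x + b) / (c * x + d) - m) ^ 2 / s ^ 2)⁻¹) =
      (π * σ)⁻¹ * (1 + (x - μ) ^ 2 / σ ^ 2)⁻¹ := by
  have hs0 : 0 < s := by rw [hs]; positivity
  rw [cauchy_density_eq hs0.ne', cauchy_density_eq hσ.ne']
  have key : s ^ 2 + ((a * x + b) / (c * x + d) - m) ^ 2 =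
      (a * d - b * c) ^ 2 * (σ ^ 2 + (x - μ) ^ 2) / ((c * x + d) ^ 2 * N) := by
    rw [hm, hs]
    field_simp
    rw [hN]
    ring
  rw [key, hs]
  have hq : σ ^ 2 + (x - μ) ^ 2 ≠ 0 := by positivity
  generalize a * d - b * c = D at *
  field_simp

lemma map_moebius_cauchyMeasure {μ σ a b c d : ℝ} (hσ : 0 < σ) (h : 0 < a * d - b * c) :
    Measure.map (fun x : ℝ => (a * x + b) / (c * x + d)) (cauchyMeasure μ σ) =
      cauchyMeasure (((a * μ + b) * (c * μ + d) + a * c * σ ^ 2) / ((c * μ + d) ^ 2 + (c * σ) ^ 2))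
        (σ * (a * d - b * c) / ((c * μ + d) ^ 2 + (c * σ) ^ 2)) := by
  have hcd : c ≠ 0 ∨ d ≠ 0 := by
    by_contra! hcd
    simp [hcd.1, hcd.2] at h
  have hca : -c ≠ 0 ∨ a ≠ 0 := by
    by_contra! hca
    simp [neg_eq_zero.1 hca.1, hca.2] at h
  have hF : Measurable (fun x : ℝ => (a * x + b) / (c * x + d)) := by fun_prop
  have hS : MeasurableSet {x : ℝ | c * x + d ≠ 0} :=
    (measurableSet_eq_fun (by fun_prop) measurable_const).compl
  have hae (A : Set ℝ) {p q : ℝ} (hpq : p ≠ 0 ∨ q ≠ 0) :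
      (A ∩ {x | p * x + q ≠ 0} : Set ℝ) =ᵐ[volume] A :=
    inter_ae_eq_left_of_ae_eq_univ (Filter.eventuallyEq_univ.2 (ae_mul_add_ne_zero hpq))
  ext A hA
  rw [Measure.map_apply hF hA, cauchyMeasure, cauchyMeasure, withDensity_apply _ (hF hA),
    withDensity_apply _ hA, ← setLIntegral_congr (hae _ hcd), ← setLIntegral_congr (hae A hca),
    ← image_moebius_preimage h.ne' A,
    lintegral_image_eq_lintegral_abs_deriv_mul ((hF hA).inter hS)
      (fun x hx => (hasDerivAt_moebius a b hx.2).hasDerivWithinAt)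
      ((injOn_moebius h.ne').mono Set.inter_subset_right)]
  refine setLIntegral_congr_fun ((hF hA).inter hS) fun x hx => ?_
  have hx' : c * x + d ≠ 0 := hx.2
  have hpos : 0 < (a * d - b * c) / (c * x + d) ^ 2 := by positivity
  rw [abs_of_pos hpos, ← ENNReal.ofReal_mul hpos.le,
    cauchy_density_moebius hσ h hx' rfl (normSq_denom_pos hσ hcd μ) rfl rfl]

/-- If `Y ∼ C(μ, σ)` and `a, b, c, d ∈ ℝ` with `a d - b c > 0`, then
`Y* = (a Y + b)/(c Y + d)` is distributed as `C(μ*, σ*)` where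
`μ* + i σ* = (a θ + b)/(c θ + d)` with `θ = μ + i σ`; moreover `σ* > 0`. -/
theorem cauchy_moebius
    {Ω : Type*} [MeasurableSpace Ω] (P : Measure Ω) [IsProbabilityMeasure P]
    (μ σ : ℝ) (hσ : 0 < σ)
    (Y : Ω → ℝ) (hY : Measure.map Y P = cauchyMeasure μ σ)
    (a b c d : ℝ) (habcd : 0 < a * d - b * c)
    (θ : ℂ) (hθ : θ = (μ : ℂ) + (σ : ℂ) * Complex.I) :
    0 < (((a : ℂ) * θ + b) / ((c : ℂ) * θ + d)).im ∧
      Measure.map (fun ω => (a * Y ω + b) / (c * Y ω + d)) P =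
        cauchyMeasure (((a : ℂ) * θ + b) / ((c : ℂ) * θ + d)).re
          (((a : ℂ) * θ + b) / ((c : ℂ) * θ + d)).im := by
  have hcd : c ≠ 0 ∨ d ≠ 0 := by
    by_contra! hcd
    simp [hcd.1, hcd.2] at habcd
  have hN := normSq_denom_pos hσ hcd μ
  have hYm : AEMeasurable Y P := by
    by_contra hYm
    rw [Measure.map_of_not_aemeasurable hYm] at hY
    exact cauchyMeasure_ne_zero μ hσ hY.symm
  subst hθ
  rw [moebius_re, moebius_im, ← map_moebius_cauchyMeasure hσ habcd, ← hY,
    AEMeasurable.map_map_of_aemeasurable (by fun_prop) hYm]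
  exact ⟨by positivity, rfl⟩
end

section
/- Let $X$ be a real random variable with the Cauchy distribution $C(\mu,\sigma)$, where $\mu\in\mathbb{R}$, $\sigma>0$. Then the random variable $R = 1/X$ (defined off the null set $\{X=0\}$) has the Cauchy distribution $C\big(\mu/(\mu^2+\sigma^2),\; \sigma/(\mu^2+\sigma^2)\big)$; that is, the pushforward of $C(\mu,\sigma)$ under $x \mapsto 1/x$ equals $C(\mu^*,\sigma^*)$ with $\mu^* = \mu/(\mu^2+\sigma^2)$ and $\sigma^* = \sigma/(\mu^2+\sigma^2)$. -/
open MeasureTheory Real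

/-- The density of the pushforward under `x ↦ x⁻¹` of a measure with density `f`. -/
theorem map_inv_withDensity_volume (f : ℝ → ENNReal) :
    Measure.map (fun x : ℝ => x⁻¹) (volume.withDensity f) =
      volume.withDensity fun x => ENNReal.ofReal |-(x ^ 2)⁻¹| * f x⁻¹ := by
  ext s hs
  have himage : (fun x : ℝ => x⁻¹) '' (s \ {0}) = (fun x : ℝ => x⁻¹) ⁻¹' s \ {0} := by
    ext x
    simp only [Set.image_inv_eq_inv, Set.mem_inv, Set.mem_sdiff, Set.mem_singleton_iff,
      Set.mem_preimage, inv_eq_zero]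
  have hae (t : Set ℝ) : (t \ {0} : Set ℝ) =ᵐ[volume] t :=
    sdiff_null_ae_eq_self (measure_singleton 0)
  rw [Measure.map_apply measurable_inv hs, withDensity_apply _ (measurable_inv hs),
    withDensity_apply _ hs, ← setLIntegral_congr (hae _), ← himage,
    lintegral_image_eq_lintegral_abs_deriv_mul (hs.diff (measurableSet_singleton 0))
      (fun x hx => (hasDerivAt_inv hx.2).hasDerivWithinAt) inv_injective.injOn,
    setLIntegral_congr (hae _)]

/-- If `X ∼ C(μ, σ)` then `1/X ∼ C(μ/(μ² + σ²), σ/(μ² + σ²))`: the pushforward of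
`C(μ, σ)` under `x ↦ 1/x` equals `C(μ*, σ*)` with `μ* = μ/(μ² + σ²)` and
`σ* = σ/(μ² + σ²)`. -/
theorem cauchy_reciprocal (μ σ : ℝ) (hσ : 0 < σ) :
    Measure.map (fun x : ℝ => x⁻¹) (cauchyMeasure μ σ) =
      cauchyMeasure (μ / (μ ^ 2 + σ ^ 2)) (σ / (μ ^ 2 + σ ^ 2)) := by
  unfold cauchyMeasure
  rw [map_inv_withDensity_volume]
  refine withDensity_congr_ae ?_
  filter_upwards [Measure.ae_ne volume 0] with x hx
  have hμσ : 0 < μ ^ 2 + σ ^ 2 := by positivity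
  rw [← ENNReal.ofReal_mul (abs_nonneg _), abs_neg, abs_of_nonneg (by positivity)]
  congr 1
  have hleft : (x ^ 2)⁻¹ * ((π * σ)⁻¹ * (1 + (x⁻¹ - μ) ^ 2 / σ ^ 2)⁻¹) =
      σ / (π * (σ ^ 2 * x ^ 2 + (1 - μ * x) ^ 2)) := by
    have : 0 < σ ^ 2 * x ^ 2 + (1 - μ * x) ^ 2 := by positivity
    have : 1 + (x⁻¹ - μ) ^ 2 / σ ^ 2 = (σ ^ 2 * x ^ 2 + (1 - μ * x) ^ 2) / (σ ^ 2 * x ^ 2) := by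
      field_simp
    rw [this]
    field_simp
  have hright : 1 + (x - μ / (μ ^ 2 + σ ^ 2)) ^ 2 / (σ / (μ ^ 2 + σ ^ 2)) ^ 2 =
      (μ ^ 2 + σ ^ 2) * (σ ^ 2 * x ^ 2 + (1 - μ * x) ^ 2) / σ ^ 2 := by
    field_simp
    ring
  rw [hleft, hright]
  have : 0 < σ ^ 2 * x ^ 2 + (1 - μ * x) ^ 2 := by positivity
  field_simp
end

section
/- Fix $n \geq 2$, real numbers $x_1,\dots,x_n$, and $\mu_0 \in \mathbb{R}$. For any $a = (a_1,\dots,a_n) \in \mathbb{R}^n$ with $\sum_{i=1}^n a_i = 1$ and $a_1 \neq 0$, set $w_k = x_k - \sum_{j=1}^n a_j x_j$ for $k = 1,\dots,n$ and define $g_a(t) = \prod_{k=1}^n \big(1+(t+w_k)^2\big)^{-1}$ for $t \in \mathbb{R}$. Then $\frac{\int_{\{t \geq \sum_i a_i x_i - \mu_0\}} g_a(t)\,dt}{\int_{\mathbb{R}} g_a(t)\,dt} \;=\; \frac{\int_{-\infty}^{\mu_0} \prod_{k=1}^n \big(1+(x_k-u)^2\big)^{-1}\,du}{\int_{\mathbb{R}}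 \prod_{k=1}^n \big(1+(x_k-u)^2\big)^{-1}\,du}$; in particular the left-hand side does not depend on the choice of $a$, and equals the flat-prior Bayesian posterior probability of the event $\{\mu \leq \mu_0\}$ for the Cauchy location model $C(\mu,1)$ with data $x_1,\dots,x_n$. -/
open MeasureTheory Real

/-- Reflection `t = s - u` carries an integral over `[s - b, ∞)` to one over `(-∞, b]`. -/
theorem setIntegral_Ici_sub_eq_setIntegral_Iic_comp_sub_left
    {E : Type*} [NormedAddCommGroup E] [NormedSpace ℝ E] (f : ℝ → E) (s b : ℝ) :
    ∫ t in Set.Ici (s - b), f t = ∫ u in Set.Iic b, f (s - u) := by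
  have h := (Measure.measurePreserving_sub_left (volume : Measure ℝ) s).setIntegral_preimage_emb
    (MeasurableEquiv.subLeft s).measurableEmbedding f (Set.Ici (s - b))
  simpa using h.symm

/-- Fix `n ≥ 2`, data `x₁, …, xₙ` and `μ₀ ∈ ℝ`.  For any `a ∈ ℝⁿ` with `∑ᵢ aᵢ = 1` and
`a₁ ≠ 0`, set `wₖ = xₖ - ∑ⱼ aⱼxⱼ` and `g_a(t) = ∏ₖ (1 + (t + wₖ)²)⁻¹`.  Then
`(∫_{t ≥ ∑ᵢaᵢxᵢ - μ₀} g_a)/(∫_ℝ g_a) = (∫_{-∞}^{μ₀} ∏ₖ(1+(xₖ-u)²)⁻¹ du)/(∫_ℝ ∏ₖ(1+(xₖ-u)²)⁻¹ du)`;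
in particular the left-hand side does not depend on `a` and equals the flat-prior Bayesian
posterior probability of `{μ ≤ μ₀}` for the Cauchy location model `C(μ, 1)`. -/
theorem cauchy_conditional_IM_posterior_eq_flat_prior_posterior
    (n : ℕ) (hn : 2 ≤ n) (x : Fin n → ℝ) (μ₀ : ℝ)
    (a : Fin n → ℝ) (hsum : ∑ i, a i = 1) (ha0 : a ⟨0, by omega⟩ ≠ 0) :
    (∫ t in Set.Ici (∑ i, a i * x i - μ₀),
        ∏ k, (1 + (t + (x k - ∑ j, a j * x j)) ^ 2)⁻¹) /
      (∫ t : ℝ, ∏ k, (1 + (t + (x k - ∑ j, a j * x j)) ^ 2)⁻¹) =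
    (∫ u in Set.Iic μ₀, ∏ k, (1 + (x k - u) ^ 2)⁻¹) /
      (∫ u : ℝ, ∏ k, (1 + (x k - u) ^ 2)⁻¹) := by
  set s := ∑ i, a i * x i
  have hf (u : ℝ) : ∏ k, (1 + (x k - u) ^ 2)⁻¹ =
      ∏ k, (1 + (s - u + (x k - s)) ^ 2)⁻¹ := by
    congr! 4
    ring
  simp_rw [hf]
  rw [setIntegral_Ici_sub_eq_setIntegral_Iic_comp_sub_left,
    integral_sub_left_eq_self (fun t ↦ ∏ k, (1 + (t + (x k - s)) ^ 2)⁻¹) volume s]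
end

section
/- Let $n \geq 1$, $\mu \in \mathbb{R}$, $\sigma > 0$, and let $X_1,\dots,X_n$ be i.i.d. random variables with the Cauchy distribution $C(\mu,\sigma)$. Then the sample mean $\frac{1}{n}\sum_{i=1}^n X_i$ also has the Cauchy distribution $C(\mu,\sigma)$; that is, the pushforward of the $n$-fold product of $C(\mu,\sigma)$ under $(x_1,\dots,x_n) \mapsto \frac{1}{n}\sum_i x_i$ equals $C(\mu,\sigma)$. -/
open MeasureTheory Real

open FourierTransform Set

/-- The Fourier transform of `x ↦ exp (-2π|x|)` is the standard Cauchy density. -/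
lemma fourier_exp_neg_two_pi_abs (w : ℝ) :
    𝓕 (fun x : ℝ => (Real.exp (-(2 * π * |x|)) : ℂ)) w = ((π⁻¹ * (1 + w ^ 2)⁻¹ : ℝ) : ℂ) := by
  have hπ := Real.pi_pos
  set a : ℂ := 2 * π * (1 - w * Complex.I) with ha
  set b : ℂ := -(2 * π * (1 + w * Complex.I)) with hb
  have har : 0 < a.re := by simpa [ha] using hπ
  have hbr : b.re < 0 := by simpa [hb] using hπ
  have hl : EqOn (fun x : ℝ => Complex.exp (↑(-2 * π * x * w) * Complex.I) •
      (Real.exp (-(2 * π * |x|)) : ℂ)) (fun x : ℝ => Complex.exp (a * x)) (Iic 0) := by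
    intro x hx
    simp only [abs_of_nonpos (mem_Iic.1 hx), smul_eq_mul, Complex.ofReal_exp, ← Complex.exp_add]
    congr 1; push_cast [ha]; ring
  have hr : EqOn (fun x : ℝ => Complex.exp (↑(-2 * π * x * w) * Complex.I) •
      (Real.exp (-(2 * π * |x|)) : ℂ)) (fun x : ℝ => Complex.exp (b * x)) (Ioi 0) := by
    intro x hx
    simp only [abs_of_pos (mem_Ioi.1 hx), smul_eq_mul, Complex.ofReal_exp, ← Complex.exp_add]
    congr 1; push_cast [hb]; ring
  rw [fourier_real_eq_integral_exp_smul, ← intervalIntegral.integral_Iic_add_Ioi (b := 0)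
    ((integrableOn_exp_mul_complex_Iic har 0).congr_fun hl.symm measurableSet_Iic)
    ((integrableOn_exp_mul_complex_Ioi hbr 0).congr_fun hr.symm measurableSet_Ioi),
    setIntegral_congr_fun measurableSet_Iic hl, setIntegral_congr_fun measurableSet_Ioi hr,
    integral_exp_mul_complex_Iic har, integral_exp_mul_complex_Ioi hbr]
  have ha0 : (1 - w * Complex.I : ℂ) ≠ 0 := fun h => by simpa using congrArg Complex.re h
  have hb0 : (1 + w * Complex.I : ℂ) ≠ 0 := fun h => by simpa using congrArg Complex.re h
  have hw : (1 + w ^ 2 : ℂ) = (1 - w * Complex.I) * (1 + w * Complex.I) := by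
    linear_combination (w : ℂ) ^ 2 * Complex.I_sq
  have hπ0 : (π : ℂ) ≠ 0 := mod_cast hπ.ne'
  push_cast
  rw [hw, ha, hb]
  simp only [mul_zero, Complex.exp_zero]
  field_simp
  ring

lemma integrable_exp_neg_two_pi_abs :
    Integrable (fun x : ℝ => (Real.exp (-(2 * π * |x|)) : ℂ)) := by
  have hπ := Real.two_pi_pos
  have hl : IntegrableOn (fun x : ℝ => Real.exp (-(2 * π * |x|))) (Iic 0) :=
    (integrableOn_exp_mul_Iic hπ 0).congr_fun
      (fun x hx => by simp [abs_of_nonpos (mem_Iic.1 hx)]) measurableSet_Iic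
  have hr : IntegrableOn (fun x : ℝ => Real.exp (-(2 * π * |x|))) (Ioi 0) :=
    (integrableOn_exp_mul_Ioi (neg_neg_of_pos hπ) 0).congr_fun
      (fun x hx => by simp [abs_of_pos (mem_Ioi.1 hx)]) measurableSet_Ioi
  have h := hl.union hr
  rw [Iic_union_Ioi, integrableOn_univ] at h
  exact h.ofReal

/-- The characteristic function of the standard Cauchy density. -/
lemma integral_exp_mul_inv_one_add_sq (t : ℝ) :
    ∫ x : ℝ, Complex.exp (t * x * Complex.I) * ((π⁻¹ * (1 + x ^ 2)⁻¹ : ℝ) : ℂ) =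
      (Real.exp (-|t|) : ℂ) := by
  have hF := funext fourier_exp_neg_two_pi_abs
  have h := congrFun (Continuous.fourierInv_fourier_eq (by fun_prop) integrable_exp_neg_two_pi_abs
    (by rw [hF]; exact (integrable_inv_one_add_sq.const_mul _).ofReal)) (t / (2 * π))
  rw [hF, fourierInv_eq'] at h
  have ht : 2 * π * |t / (2 * π)| = |t| := by
    rw [abs_div, abs_of_pos Real.two_pi_pos, mul_div_cancel₀ _ Real.two_pi_pos.ne']
  rw [ht] at h
  rw [← h]
  congr! 3 with x
  rw [show (2 * π * inner ℝ x (t / (2 * π))) = t * x by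
    simp; field_simp]
  push_cast; rfl

lemma isFiniteMeasure_cauchyMeasure (μ : ℝ) {σ : ℝ} (hσ : σ ≠ 0) :
    IsFiniteMeasure (cauchyMeasure μ σ) := by
  apply isFiniteMeasure_withDensity_ofReal
  have h := ((integrable_inv_one_add_sq.comp_div hσ).comp_sub_right μ).const_mul (π * σ)⁻¹
  simpa [div_pow] using h.2

lemma charFun_cauchyMeasure (μ : ℝ) {σ : ℝ} (hσ : 0 < σ) (t : ℝ) :
    charFun (cauchyMeasure μ σ) t = Complex.exp (μ * t * Complex.I - σ * |t|) := by
  rw [charFun_apply_real, cauchyMeasure, integral_withDensity_eq_integral_toReal_smul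
    (by fun_prop) (by simp)]
  let g : ℝ → ℂ := fun y => (σ⁻¹ * Complex.exp (t * μ * Complex.I)) *
    (Complex.exp ((σ * t : ℝ) * y * Complex.I) * ((π⁻¹ * (1 + y ^ 2)⁻¹ : ℝ) : ℂ))
  calc _ = ∫ x : ℝ, g ((x - μ) / σ) := by
        refine integral_congr_ae (ae_of_all _ fun x => ?_)
        have hσ' : (σ : ℂ) ≠ 0 := mod_cast hσ.ne'
        beta_reduce
        rw [ENNReal.toReal_ofReal (by positivity), Complex.real_smul]
        have he : Complex.exp (t * x * Complex.I) = Complex.exp (t * μ * Complex.I) *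
            Complex.exp ((σ * t : ℝ) * ((x - μ) / σ : ℝ) * Complex.I) := by
          rw [← Complex.exp_add]
          congr 1
          push_cast
          field_simp
          ring
        simp only [g]
        rw [he, div_pow]
        push_cast
        rw [mul_inv]
        ring
    _ = _ := by
        rw [integral_sub_right_eq_self (fun x => g (x / σ)) μ, Measure.integral_comp_div,
          integral_const_mul, integral_exp_mul_inv_one_add_sq, abs_mul, abs_of_pos hσ,
          Complex.real_smul, Complex.ofReal_exp]
        have hσ' : (σ : ℂ) ≠ 0 := mod_cast hσ.ne'
        rw [← mul_assoc, Complex.ofReal_inv, mul_inv_cancel_left₀ hσ', ← Complex.exp_add]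
        congr 1
        push_cast
        ring

lemma isProbabilityMeasure_cauchyMeasure (μ : ℝ) {σ : ℝ} (hσ : 0 < σ) :
    IsProbabilityMeasure (cauchyMeasure μ σ) := by
  have := isFiniteMeasure_cauchyMeasure μ hσ.ne'
  have h := charFun_cauchyMeasure μ hσ 0
  rw [charFun_zero] at h
  rw [isProbabilityMeasure_iff_real]
  simpa using h

/-- Stability of the Cauchy distribution: if `X₁, …, Xₙ` are i.i.d. `C(μ, σ)` (`n ≥ 1`),
then the sample mean `n⁻¹ ∑ᵢ Xᵢ` is again `C(μ, σ)`-distributed; that is, the pushforward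
of the `n`-fold product of `C(μ, σ)` under `(x₁, …, xₙ) ↦ n⁻¹ ∑ᵢ xᵢ` equals `C(μ, σ)`. -/
theorem cauchy_sample_mean
    (n : ℕ) (hn : 1 ≤ n) (μ σ : ℝ) (hσ : 0 < σ) :
    Measure.map (fun x : Fin n → ℝ => (∑ i, x i) / n)
      (Measure.pi fun _ : Fin n => cauchyMeasure μ σ) = cauchyMeasure μ σ := by
  have := isProbabilityMeasure_cauchyMeasure μ hσ
  have hn0 : (0 : ℝ) < n := by exact_mod_cast hn
  have := Measure.isProbabilityMeasure_map (μ := Measure.pi fun _ : Fin n => cauchyMeasure μ σ)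
    (f := fun x => (∑ i, x i) / n) (by fun_prop)
  refine Measure.ext_of_charFun (funext fun t => ?_)
  simp only [div_eq_inv_mul]
  rw [charFun_map_mul_comp (by fun_prop), ProbabilityTheory.charFun_map_sum_pi_eq_prod]
  simp only [Finset.prod_const, Pi.pow_apply, Finset.card_univ, Fintype.card_fin,
    charFun_cauchyMeasure μ hσ, ← Complex.exp_nat_mul, abs_mul, abs_inv, abs_of_pos hn0]
  have hn' : (n : ℂ) ≠ 0 := mod_cast hn0.ne'
  congr 1
  push_cast
  field_simp
end

section
/- Let $n \geq 3$ and let $x_1 < x_2 < \cdots < x_n$ be real numbers; set $w_i = (x_i - x_1)/(x_2 - x_1)$ for $i = 3,\dots,n$. Let $S$ be a random variable on $(0,\infty)$ with density proportional to $s \mapsto s^{n-2}\int_{-\infty}^{\infty}(1+t^2)^{-1}(1+(t+s)^2)^{-1}\prod_{i=3}^n(1+(t+w_i s)^2)^{-1}\,dt$. Then $G = (x_2 - x_1)/S$ has density on $(0,\infty)$ proportional to $g \mapsto \frac{1}{g^{n+1}} \int_{-\infty}^{\infty} \prod_{i=1}^n \frac{1}{1 + (x_i - u)^2/g^2}\,du$.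 -/
open MeasureTheory Real

/-- Division into a positive constant, `s ↦ d / s`, pushes a density on `(0, ∞)` forward to its
Jacobian transform. -/
lemma map_const_div_withDensity {d : ℝ} (hd : 0 < d) {f h : ℝ → ENNReal}
    (hf : ∀ s ≤ 0, f s = 0) (hh : ∀ g ≤ 0, h g = 0)
    (hfh : ∀ g, 0 < g → h g = ENNReal.ofReal (d / g ^ 2) * f (d / g)) :
    Measure.map (fun s => d / s) (volume.withDensity f) = volume.withDensity h := by
  have hm : Measurable fun s : ℝ => d / s := measurable_const.div measurable_id
  have restrict_pos : ∀ k : ℝ → ENNReal, (∀ s ≤ 0, k s = 0) → ∀ A : Set ℝ,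
      ∫⁻ s in A, k s = ∫⁻ s in Set.Ioi 0 ∩ A, k s := by
    intro k hk A
    have hki : k = (Set.Ioi 0).indicator k := by
      ext s
      by_cases hs : 0 < s
      · simp [hs]
      · simp [hs, hk s (not_lt.mp hs)]
    conv_lhs => rw [hki]
    rw [setLIntegral_indicator measurableSet_Ioi]
  ext A hA
  rw [Measure.map_apply hm hA, withDensity_apply _ (hm hA), withDensity_apply _ hA,
    restrict_pos f hf, restrict_pos h hh]
  have hmeas : MeasurableSet (Set.Ioi 0 ∩ A) := measurableSet_Ioi.inter hA
  have himage : Set.Ioi 0 ∩ (fun s => d / s) ⁻¹' A = (fun s => d / s) '' (Set.Ioi 0 ∩ A) := by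
    ext s
    constructor
    · rintro ⟨hs, hsA⟩
      exact ⟨d / s, ⟨div_pos hd hs, hsA⟩, div_div_cancel₀ hd.ne'⟩
    · rintro ⟨g, ⟨hg, hgA⟩, rfl⟩
      refine ⟨div_pos hd hg, ?_⟩
      rwa [Set.mem_preimage, div_div_cancel₀ hd.ne']
  have hderiv : ∀ g ∈ Set.Ioi 0 ∩ A,
      HasDerivWithinAt (fun s => d / s) (-(d / g ^ 2)) (Set.Ioi 0 ∩ A) g := by
    rintro g ⟨hg, -⟩
    have := ((hasDerivAt_inv (ne_of_gt hg)).const_mul d).hasDerivWithinAt (s := Set.Ioi 0 ∩ A)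
    simpa only [div_eq_mul_inv, mul_neg] using this
  have hinj : Set.InjOn (fun s => d / s) (Set.Ioi 0 ∩ A) := by
    intro a _ b _ hab
    have := congrArg (fun y => d / y) hab
    simpa only [div_div_cancel₀ hd.ne'] using this
  rw [himage, lintegral_image_eq_lintegral_abs_deriv_mul hmeas hderiv hinj]
  refine setLIntegral_congr_fun hmeas ?_
  rintro g ⟨hg, -⟩
  have hg' : (0 : ℝ) < g := hg
  simp only [abs_neg, hfh g hg', abs_of_pos (div_pos hd (pow_pos hg' 2))]

/-- Pushing forward along `s ↦ d / s` commutes with composition even when `S` is not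
a.e. measurable. -/
lemma map_const_div {Ω : Type*} [MeasurableSpace Ω] (P : Measure Ω) {d : ℝ} (hd : d ≠ 0)
    (S : Ω → ℝ) :
    Measure.map (fun ω => d / S ω) P = Measure.map (fun s => d / s) (Measure.map S P) := by
  have hm : Measurable fun s : ℝ => d / s := measurable_const.div measurable_id
  by_cases hS : AEMeasurable S P
  · exact (AEMeasurable.map_map_of_aemeasurable hm.aemeasurable hS).symm
  · have hG : ¬ AEMeasurable (fun ω => d / S ω) P := fun hG => hS <| by
      simpa only [Function.comp_def, div_div_cancel₀ hd] using hm.comp_aemeasurable hG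
    rw [Measure.map_of_not_aemeasurable hS, Measure.map_of_not_aemeasurable hG, Measure.map_zero]

/-- Substitution `t = (a - u) / g` in an integral over the real line. -/
lemma integral_comp_sub_div {g : ℝ} (hg : 0 < g) (a : ℝ) (k : ℝ → ℝ) :
    ∫ t, k t = g⁻¹ * ∫ u, k ((a - u) / g) := by
  rw [integral_sub_left_eq_self (fun v => k (v / g)) volume a, Measure.integral_comp_div,
    abs_of_pos hg, smul_eq_mul, inv_mul_cancel_left₀ hg.ne']

/-- Let `n ≥ 3`, `x₁ < ⋯ < xₙ`, `wᵢ = (xᵢ - x₁)/(x₂ - x₁)` (`i = 3, …, n`), and let `S`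
be a random variable on `(0, ∞)` with density proportional to
`s ↦ s^(n-2) ∫ (1+t²)⁻¹(1+(t+s)²)⁻¹ ∏ᵢ(1+(t+wᵢs)²)⁻¹ dt`.  Then `G = (x₂ - x₁)/S` has
density on `(0, ∞)` proportional to `g ↦ g⁻⁽ⁿ⁺¹⁾ ∫ ∏ᵢ (1 + (xᵢ - u)²/g²)⁻¹ du`. -/
theorem propagated_density_scale
    {Ω : Type*} [MeasurableSpace Ω] (P : Measure Ω) [IsProbabilityMeasure P]
    (n : ℕ) (hn : 3 ≤ n) (x : Fin n → ℝ) (hx : StrictMono x)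
    (S : Ω → ℝ) (c : ℝ) (hc : 0 < c)
    (hS : Measure.map S P = volume.withDensity fun s =>
      ENNReal.ofReal (if 0 < s then
        c * (s ^ (n - 2) *
          ∫ t : ℝ, (1 + t ^ 2)⁻¹ * (1 + (t + s) ^ 2)⁻¹ *
            ∏ i : Fin (n - 2),
              (1 + (t + (x ⟨i.1 + 2, by have := i.2; omega⟩ - x ⟨0, by omega⟩) /
                (x ⟨1, by omega⟩ - x ⟨0, by omega⟩) * s) ^ 2)⁻¹)
      else 0)) :
    ∃ c' > (0 : ℝ),
      Measure.map (fun ω => (x ⟨1, by omega⟩ - x ⟨0, by omega⟩) / S ω) P =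
        volume.withDensity fun g =>
          ENNReal.ofReal (if 0 < g then
            c' * ((g ^ (n + 1))⁻¹ *
              ∫ u : ℝ, ∏ i : Fin n, (1 + (x i - u) ^ 2 / g ^ 2)⁻¹)
          else 0) := by
  obtain ⟨m, rfl⟩ : ∃ m, n = m + 2 := ⟨n - 2, by omega⟩
  have hd : 0 < x ⟨1, by omega⟩ - x ⟨0, by omega⟩ := sub_pos.mpr (hx (by simp))
  refine ⟨c * (x ⟨1, by omega⟩ - x ⟨0, by omega⟩) ^ (m + 1), by positivity, ?_⟩
  rw [map_const_div P hd.ne' S, hS]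
  refine map_const_div_withDensity hd (fun s hs => by simp [not_lt.mpr hs])
    (fun g hg => by simp [not_lt.mpr hg]) fun g hg => ?_
  rw [if_pos hg, if_pos (div_pos hd hg), ← ENNReal.ofReal_mul (by positivity)]
  conv_rhs => rw [integral_comp_sub_div hg (x ⟨0, by omega⟩)]
  congr 1
  have hint : ∀ u : ℝ, ∏ i : Fin (m + 2), (1 + (x i - u) ^ 2 / g ^ 2)⁻¹ =
      (1 + ((x ⟨0, by omega⟩ - u) / g) ^ 2)⁻¹ *
        (1 + ((x ⟨0, by omega⟩ - u) / g +
          (x ⟨1, by omega⟩ - x ⟨0, by omega⟩) / g) ^ 2)⁻¹ *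
        ∏ i : Fin (m + 2 - 2),
          (1 + ((x ⟨0, by omega⟩ - u) / g +
            (x ⟨i.1 + 2, by have := i.2; omega⟩ - x ⟨0, by omega⟩) /
              (x ⟨1, by omega⟩ - x ⟨0, by omega⟩) *
              ((x ⟨1, by omega⟩ - x ⟨0, by omega⟩) / g)) ^ 2)⁻¹ := by
    intro u
    rw [Fin.prod_univ_succ, Fin.prod_univ_succ, ← mul_assoc]
    simp only [div_mul_div_cancel₀ hd.ne', ← add_div, sub_add_sub_cancel', div_pow]
    rfl
  simp only [hint, Nat.add_sub_cancel, div_pow _ g m]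
  generalize (∫ u : ℝ, _ : ℝ) = I
  field_simp
  ring
end

section
/- Let $n \geq 3$ and let $x_1 < x_2 < \cdots < x_n$ be real numbers; set $w_i = (x_i - x_1)/(x_2 - x_1)$ for $i = 3,\dots,n$. Let $M$ be a random variable with density proportional to $m \mapsto \int_0^{\infty} s^{n-1}(1+m^2 s^2)^{-1}(1+(ms+s)^2)^{-1}\prod_{i=3}^n(1+(ms+w_i s)^2)^{-1}\,ds$. Then $Z = x_1 - (x_2 - x_1) M$ has density on $\mathbb{R}$ proportional to $z \mapsto \int_0^{\infty} \frac{1}{s^{n+1}} \prod_{i=1}^n \frac{1}{1 + (z - x_i)^2/s^2}\,ds$. -/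
open MeasureTheory Real

/-- The affine change of variables `m ↦ a - d * m` applied to a measure with a density. -/
theorem map_sub_mul_withDensity (a : ℝ) {d : ℝ} (hd : 0 < d) (g : ℝ → ENNReal) :
    Measure.map (fun m => a - d * m)
      (volume.withDensity fun m => ENNReal.ofReal d * g (a - d * m)) =
      volume.withDensity g := by
  have hemb : MeasurableEmbedding fun m : ℝ => a - d * m :=
    (measurableEmbedding_subLeft a).comp (measurableEmbedding_mulLeft₀ hd.ne')
  have hvol : Measure.map (fun m : ℝ => a - d * m) volume = ENNReal.ofReal d⁻¹ • volume := by
    have hcomp : (fun m : ℝ => a - d * m) = (fun y => a - y) ∘ (d * ·) := rfl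
    rw [hcomp, ← Measure.map_map (by fun_prop) (by fun_prop), Real.map_volume_mul_left hd.ne',
      Measure.map_smul, (volume.measurePreserving_sub_left a).map_eq, abs_of_pos (inv_pos.2 hd)]
  ext s hs
  rw [hemb.map_apply, withDensity_apply _ (hemb.measurable hs), withDensity_apply _ hs,
    lintegral_const_mul' _ _ ENNReal.ofReal_ne_top, ← hemb.lintegral_map g, ← hemb.restrict_map,
    hvol, Measure.restrict_smul, lintegral_smul_measure, smul_eq_mul, ← mul_assoc,
    ← ENNReal.ofReal_mul hd.le, mul_inv_cancel₀ hd.ne', ENNReal.ofReal_one, one_mul]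

/-- The substitution `s = d / t` on the positive half-line. -/
theorem integral_Ioi_comp_div {d : ℝ} (hd : 0 < d) (f : ℝ → ℝ) :
    ∫ s in Set.Ioi (0 : ℝ), f s = ∫ t in Set.Ioi (0 : ℝ), d / t ^ 2 * f (d / t) := by
  have himage : (fun t : ℝ => d / t) '' Set.Ioi 0 = Set.Ioi 0 := by
    ext y
    simp only [Set.mem_image, Set.mem_Ioi]
    constructor
    · rintro ⟨t, ht, rfl⟩
      positivity
    · exact fun hy => ⟨d / y, by positivity, by field_simp⟩
  have hderiv : ∀ t ∈ Set.Ioi (0 : ℝ),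
      HasDerivWithinAt (fun t => d / t) (-d / t ^ 2) (Set.Ioi 0) t := by
    intro t ht
    have h := ((hasDerivAt_inv (ne_of_gt ht)).const_mul d).hasDerivWithinAt (s := Set.Ioi 0)
    simpa only [div_eq_mul_inv, mul_neg, neg_mul] using h
  have hinj : Set.InjOn (fun t : ℝ => d / t) (Set.Ioi 0) := fun _ _ _ _ h => by
    simpa [div_eq_mul_inv, hd.ne'] using h
  have h := integral_image_eq_integral_abs_deriv_smul measurableSet_Ioi hderiv hinj f
  rw [himage] at h
  rw [h]
  refine setIntegral_congr_fun measurableSet_Ioi fun t _ => ?_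
  simp only [smul_eq_mul]
  rw [neg_div, abs_neg, abs_of_nonneg (by positivity)]

/-- The marginal integral for the Cauchy pivot at `m` is `d ^ n` times the posterior integral at
`z = x₀ - d * m`, where `d = x₁ - x₀` and `n = k + 2`. -/
theorem integral_cauchy_pivot_eq (k : ℕ) (x : Fin (k + 2) → ℝ) (hd : 0 < x 1 - x 0) (m : ℝ) :
    ∫ s in Set.Ioi (0 : ℝ), s ^ (k + 1) * (1 + m ^ 2 * s ^ 2)⁻¹ * (1 + (m * s + s) ^ 2)⁻¹ *
        ∏ i : Fin k, (1 + (m * s + (x i.succ.succ - x 0) / (x 1 - x 0) * s) ^ 2)⁻¹ =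
      (x 1 - x 0) ^ (k + 2) * ∫ t in Set.Ioi (0 : ℝ), (t ^ (k + 3))⁻¹ *
        ∏ i, (1 + (x 0 - (x 1 - x 0) * m - x i) ^ 2 / t ^ 2)⁻¹ := by
  rw [integral_Ioi_comp_div hd, ← integral_const_mul]
  refine setIntegral_congr_fun measurableSet_Ioi fun t (ht : 0 < t) => ?_
  have hx₁ : x 1 = x 0 + (x 1 - x 0) := by ring
  generalize x 1 - x 0 = d at *
  simp only [Fin.prod_univ_succ, Fin.succ_zero_eq_one, hx₁]
  have hpivot : ∀ i : Fin k, m * (d / t) + (x i.succ.succ - x 0) / d * (d / t) =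
      -((x 0 - d * m - x i.succ.succ) / t) := by
    intro i
    field_simp
    ring
  have h₀ : m ^ 2 * (d / t) ^ 2 = (x 0 - d * m - x 0) ^ 2 / t ^ 2 := by
    field_simp
    ring
  have h₁ : (m * (d / t) + d / t) ^ 2 = (x 0 - d * m - (x 0 + d)) ^ 2 / t ^ 2 := by
    field_simp
    ring
  simp only [hpivot, h₀, h₁, neg_sq]
  simp only [div_pow]
  have hpow : d / t ^ 2 * (d ^ (k + 1) / t ^ (k + 1)) = d ^ (k + 2) * (t ^ (k + 3))⁻¹ := by
    field_simp
    ring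
  linear_combination ((1 + (x 0 - d * m - x 0) ^ 2 / t ^ 2)⁻¹ *
    (1 + (x 0 - d * m - (x 0 + d)) ^ 2 / t ^ 2)⁻¹ *
    ∏ i : Fin k, (1 + (x 0 - d * m - x i.succ.succ) ^ 2 / t ^ 2)⁻¹) * hpow

/-- Composing with `y ↦ a - d * y` commutes with `Measure.map`, also for functions that are not
almost everywhere measurable. -/
theorem map_sub_mul_comp {Ω : Type*} [MeasurableSpace Ω] (P : Measure Ω) (M : Ω → ℝ) (a : ℝ)
    {d : ℝ} (hd : d ≠ 0) :
    Measure.map (fun ω => a - d * M ω) P = Measure.map (fun m => a - d * m) (Measure.map M P) := by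
  by_cases hM : AEMeasurable M P
  · exact (AEMeasurable.map_map_of_aemeasurable (g := fun m => a - d * m) (by fun_prop) hM).symm
  · have hZ : ¬AEMeasurable (fun ω => a - d * M ω) P := fun h => hM <| by
      have h' := (h.const_sub a).const_mul d⁻¹
      simpa [hd] using h'
    rw [Measure.map_of_not_aemeasurable hM, Measure.map_of_not_aemeasurable hZ, Measure.map_zero]

/-- Let `n ≥ 3`, `x₁ < ⋯ < xₙ`, `wᵢ = (xᵢ - x₁)/(x₂ - x₁)` (`i = 3, …, n`), and let `M`
have density proportional to
`m ↦ ∫₀^∞ s^(n-1)(1+m²s²)⁻¹(1+(ms+s)²)⁻¹ ∏ᵢ(1+(ms+wᵢs)²)⁻¹ ds`.  Then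
`Z = x₁ - (x₂ - x₁) M` has density on `ℝ` proportional to
`z ↦ ∫₀^∞ s⁻⁽ⁿ⁺¹⁾ ∏ᵢ (1 + (z - xᵢ)²/s²)⁻¹ ds`. -/
theorem propagated_density_location
    {Ω : Type*} [MeasurableSpace Ω] (P : Measure Ω) [IsProbabilityMeasure P]
    (n : ℕ) (hn : 3 ≤ n) (x : Fin n → ℝ) (hx : StrictMono x)
    (M : Ω → ℝ) (c : ℝ) (hc : 0 < c)
    (hM : Measure.map M P = volume.withDensity fun m =>
      ENNReal.ofReal (c *
        ∫ s in Set.Ioi (0 : ℝ),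
          s ^ (n - 1) * (1 + m ^ 2 * s ^ 2)⁻¹ * (1 + (m * s + s) ^ 2)⁻¹ *
            ∏ i : Fin (n - 2),
              (1 + (m * s + (x ⟨i.1 + 2, by have := i.2; omega⟩ - x ⟨0, by omega⟩) /
                (x ⟨1, by omega⟩ - x ⟨0, by omega⟩) * s) ^ 2)⁻¹)) :
    ∃ c' > (0 : ℝ),
      Measure.map
        (fun ω => x ⟨0, by omega⟩ - (x ⟨1, by omega⟩ - x ⟨0, by omega⟩) * M ω) P =
      volume.withDensity fun z =>
        ENNReal.ofReal (c' *
          ∫ s in Set.Ioi (0 : ℝ),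
            (s ^ (n + 1))⁻¹ * ∏ i : Fin n, (1 + (z - x i) ^ 2 / s ^ 2)⁻¹) := by
  obtain ⟨k, rfl⟩ : ∃ k, n = k + 2 := ⟨n - 2, by omega⟩
  have hd : 0 < x 1 - x 0 := sub_pos.2 (hx (by simp))
  refine ⟨c * (x 1 - x 0) ^ (k + 1), by positivity, ?_⟩
  refine (map_sub_mul_comp P M (x 0) hd.ne').trans ?_
  refine Eq.trans ?_ (map_sub_mul_withDensity (x 0) hd _)
  rw [hM]
  congr 2
  funext m
  rw [← ENNReal.ofReal_mul hd.le]
  congr 1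
  refine (congrArg (c * ·) (integral_cauchy_pivot_eq k x hd m)).trans ?_
  ring
end
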